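/- arXiv:1604.04841 — 3 statements merged into one kernel-verified Lean document; each statement's English description precedes it below -/
import Mathlib

section
/- (Frank–Wolfe-type theorem 2) Suppose: (i) T and each T_i (i = 1,…,m) are compact operators with closed range; (ii) the constraint set F is nonempty and f is bounded from below on F; (iii) condition (A) holds. Then f attains its infimum on F. -/
open scoped RealInnerProductSpace
open Filter Topology

/-- A sequence `x` in a real inner product space converges weakly to `x₀` if
`⟪a, x k⟫ → ⟪a, x₀⟫` for every `a`. -/
def WeaklyConvergesTo {H : Type*} [NormedAddCommGroup H] [InnerProductSpace ℝ H]
    (x : ℕ → H) (x₀ : H) : Prop :=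
  ∀ a : H, Tendsto (fun k => ⟪a, x k⟫) atTop (𝓝 ⟪a, x₀⟫)

/-- The recession cone `0⁺X = {v | x + t • v ∈ X for all x ∈ X and t ≥ 0}`. -/
def recessionCone {H : Type*} [NormedAddCommGroup H] [InnerProductSpace ℝ H]
    (X : Set H) : Set H :=
  {v | ∀ x ∈ X, ∀ t : ℝ, 0 ≤ t → x + t • v ∈ X}

/-- A (continuous linear) operator is compact if it maps every weakly convergent sequence
to a strongly convergent sequence. -/
def CompactOp {H : Type*} [NormedAddCommGroup H] [InnerProductSpace ℝ H]
    (A : H →L[ℝ] H) : Prop :=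
  ∀ (x : ℕ → H) (x₀ : H), WeaklyConvergesTo x x₀ →
    Tendsto (fun k => A (x k)) atTop (𝓝 (A x₀))

lemma eq_zero_of_inner_apply_self_nonpos {H : Type*} [NormedAddCommGroup H]
    [InnerProductSpace ℝ H] (A : H →L[ℝ] H) (hA : ∀ x y : H, ⟪A x, y⟫ = ⟪x, A y⟫)
    (hpos : ∀ x : H, 0 ≤ ⟪x, A x⟫) {v : H} (hv : ⟪v, A v⟫ ≤ 0) : A v = 0 := by
  have hv0 : ⟪v, A v⟫ = 0 := le_antisymm hv (hpos v)
  have key : ∀ s : ℝ, 0 ≤ ⟪A v, A (A v)⟫ * (s * s) + 2 * ⟪A v, A v⟫ * s + 0 := by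
    intro s
    have h := hpos (v + s • A v)
    rw [map_add, map_smul, inner_add_left, inner_add_right, inner_add_right, inner_smul_left,
      inner_smul_left, inner_smul_right, inner_smul_right, hv0, ← hA v (A v)] at h
    simp only [conj_trivial] at h
    linarith
  have h := discrim_le_zero key
  rw [discrim] at h
  rw [← inner_self_eq_zero (𝕜 := ℝ)]
  nlinarith

lemma Orthonormal.weaklyConvergesTo_zero {H : Type*} [NormedAddCommGroup H]
    [InnerProductSpace ℝ H] {e : ℕ → H} (he : Orthonormal ℝ e) : WeaklyConvergesTo e 0 := by
  intro a
  have h := (he.inner_products_summable (x := a)).tendsto_atTop_zero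
  have h' := h.sqrt
  simp only [Real.sqrt_sq (norm_nonneg _), Real.sqrt_zero] at h'
  rw [inner_zero_right]
  refine (tendsto_zero_iff_norm_tendsto_zero.2 h').congr fun k => ?_
  exact real_inner_comm _ _

lemma exists_orthonormal_nat {E : Type*} [NormedAddCommGroup E] [InnerProductSpace ℝ E]
    [CompleteSpace E] (hE : ¬ FiniteDimensional ℝ E) : ∃ e : ℕ → E, Orthonormal ℝ e := by
  obtain ⟨w, b, -⟩ := exists_hilbertBasis ℝ E
  by_cases hw : Finite w
  · have := Fintype.ofFinite w
    exact absurd (Module.Basis.finiteDimensional_of_finite b.toOrthonormalBasis.toBasis) hE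
  · rw [not_finite_iff_infinite] at hw
    exact ⟨_, b.orthonormal.comp _ (Infinite.natEmbedding w).injective⟩

/-- A self-adjoint compact operator with closed range has finite rank. -/
lemma CompactOp.finiteDimensional_range {H : Type*} [NormedAddCommGroup H]
    [InnerProductSpace ℝ H] [CompleteSpace H] {A : H →L[ℝ] H} (hA : CompactOp A)
    (hsa : ∀ x y : H, ⟪A x, y⟫ = ⟪x, A y⟫) (hr : IsClosed (Set.range fun x => A x)) :
    FiniteDimensional ℝ A.range := by
  have hc : IsClosed (A.range : Set H) := hr
  have : CompleteSpace A.range := hc.completeSpace_coe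
  set B : A.range →L[ℝ] H := A.comp A.range.subtypeL with hB
  have hinj : Function.Injective B := by
    rw [injective_iff_map_eq_zero]
    rintro ⟨_, y, rfl⟩ hx
    have hx' : A (A y) = 0 := hx
    have h0 : A y = 0 := by
      rw [← inner_self_eq_zero (𝕜 := ℝ), hsa, hx', inner_zero_right]
    exact Subtype.ext h0
  have hker : ∀ z ∈ A.rangeᗮ, A z = 0 := by
    intro z hz
    rw [← inner_self_eq_zero (𝕜 := ℝ), hsa, real_inner_comm]
    exact hz _ ⟨A z, rfl⟩
  have hBr : Set.range B = Set.range fun x => A x := by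
    apply Set.Subset.antisymm
    · rintro _ ⟨x, rfl⟩
      exact ⟨x, rfl⟩
    · rintro _ ⟨x, rfl⟩
      obtain ⟨y, hy, z, hz, rfl⟩ := A.range.exists_add_mem_mem_orthogonal x
      exact ⟨⟨y, hy⟩, by simp [hB, hker z hz]⟩
  obtain ⟨K, hK⟩ := B.antilipschitz_of_injective_of_isClosed_range hinj (hBr ▸ hr)
  by_contra hfin
  obtain ⟨e, he⟩ := exists_orthonormal_nat hfin
  have hlim := hA _ _ (he.comp_linearIsometry A.range.subtypeₗᵢ).weaklyConvergesTo_zero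
  rw [map_zero] at hlim
  have hlim' := (hlim.norm).const_mul (K : ℝ)
  rw [norm_zero, mul_zero] at hlim'
  refine absurd (ge_of_tendsto' hlim' (b := 1) fun k => ?_) (by norm_num)
  have := hK.le_mul_dist (e k) 0
  rw [dist_zero_right, map_zero, dist_zero_right, he.1 k] at this
  exact this

lemma inner_nonpos_of_tendsto {H : Type*} [NormedAddCommGroup H] [InnerProductSpace ℝ H]
    {w : ℕ → H} {d : ℕ → ℝ} {v c : H} {B : ℝ} (hw : Tendsto w atTop (𝓝 v))
    (hd : Tendsto d atTop atTop) (hB : ∀ k, ⟪c, d k • w k⟫ ≤ B) : ⟪c, v⟫ ≤ 0 := by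
  by_contra! h
  have h1 : Tendsto (fun k => ⟪c, w k⟫) atTop (𝓝 ⟪c, v⟫) := tendsto_const_nhds.inner hw
  have h2 := hd.atTop_mul_pos h h1
  obtain ⟨k, hk⟩ := (h2.eventually_gt_atTop B).exists
  have := hB k
  rw [inner_smul_right] at this
  linarith

lemma inner_apply_self_nonpos_of_tendsto {H : Type*} [NormedAddCommGroup H]
    [InnerProductSpace ℝ H] (A : H →L[ℝ] H) {w : ℕ → H} {d : ℕ → ℝ} {v c : H} {B : ℝ}
    (hw : Tendsto w atTop (𝓝 v)) (hd : Tendsto d atTop atTop)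
    (hB : ∀ k, (1/2 : ℝ) * ⟪d k • w k, A (d k • w k)⟫ + ⟪c, d k • w k⟫ ≤ B) :
    ⟪v, A v⟫ ≤ 0 := by
  by_contra! h
  have h1 : Tendsto (fun k => ⟪w k, A (w k)⟫) atTop (𝓝 ⟪v, A v⟫) :=
    hw.inner ((A.continuous.tendsto v).comp hw)
  have h2 : Tendsto (fun k => ⟪c, w k⟫) atTop (𝓝 ⟪c, v⟫) := tendsto_const_nhds.inner hw
  have h3 : Tendsto (fun k => d k * ((1/2 : ℝ) * ⟪w k, A (w k)⟫) + ⟪c, w k⟫) atTop atTop :=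
    (hd.atTop_mul_pos (by linarith) (h1.const_mul (1/2 : ℝ))).atTop_add h2
  have h4 := hd.atTop_mul_atTop₀ h3
  obtain ⟨k, hk⟩ := (h4.eventually_gt_atTop B).exists
  have := hB k
  rw [map_smul, inner_smul_left, inner_smul_right, inner_smul_right, conj_trivial] at this
  nlinarith

lemma quadratic_bddBelow_on_ray {a b e B : ℝ}
    (h : ∀ t : ℝ, 0 ≤ t → B ≤ a + b * t + e * (t * t)) : 0 ≤ e ∧ (e = 0 → 0 ≤ b) := by
  have key : ∀ p : ℝ, p < 0 → Tendsto (fun t : ℝ => p * t) atTop atBot := fun p hp =>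
    tendsto_id.const_mul_atTop_of_neg hp
  constructor
  · by_contra! he
    have h1 := (tendsto_atBot_add_const_left _ b (key e he))
    have h2 := tendsto_atBot_add_const_left _ a (tendsto_id.atTop_mul_atBot₀ h1)
    obtain ⟨t, ht, ht0⟩ := ((h2.eventually_lt_atBot B).and (eventually_ge_atTop 0)).exists
    have := h t ht0
    simp only [id] at ht
    nlinarith
  · rintro rfl
    by_contra! hb
    have h2 := tendsto_atBot_add_const_left _ a (key b hb)
    obtain ⟨t, ht, ht0⟩ := ((h2.eventually_lt_atBot B).and (eventually_ge_atTop 0)).exists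
    have := h t ht0
    linarith

lemma quadratic_add_smul {H : Type*} [NormedAddCommGroup H] [InnerProductSpace ℝ H]
    (A : H →L[ℝ] H) (hA : ∀ x y : H, ⟪A x, y⟫ = ⟪x, A y⟫) (c x v : H) (t : ℝ) :
    (1/2 : ℝ) * ⟪x + t • v, A (x + t • v)⟫ + ⟪c, x + t • v⟫ =
      ((1/2 : ℝ) * ⟪x, A x⟫ + ⟪c, x⟫) + (⟪x, A v⟫ + ⟪c, v⟫) * t
        + (1/2 * ⟪v, A v⟫) * (t * t) := by
  have h : ⟪v, A x⟫ = ⟪x, A v⟫ := by rw [← hA, real_inner_comm]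
  simp only [map_add, map_smul, inner_add_left, inner_add_right, inner_smul_left,
    inner_smul_right, conj_trivial, h]
  ring

/-- Frank–Wolfe-type theorem 2: if `T` and all `Tᵢ` are compact with closed range, `F` is
nonempty, `f` is bounded from below on `F` and condition (A) holds, then `f` attains its
infimum on `F`. -/
theorem frank_wolfe_type_2
    {H : Type*} [NormedAddCommGroup H] [InnerProductSpace ℝ H] [CompleteSpace H]
    {m : ℕ} (T : H →L[ℝ] H) (hT_sa : ∀ x y : H, ⟪T x, y⟫ = ⟪x, T y⟫) (c : H)
    (Ti : Fin m → H →L[ℝ] H)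
    (hTi_sa : ∀ i, ∀ x y : H, ⟪Ti i x, y⟫ = ⟪x, Ti i y⟫)
    (hTi_pos : ∀ i, ∀ x : H, 0 ≤ ⟪x, Ti i x⟫)
    (ci : Fin m → H) (α : Fin m → ℝ)
    (f : H → ℝ) (hf : ∀ x, f x = (1/2 : ℝ) * ⟪x, T x⟫ + ⟪c, x⟫)
    (F : Set H)
    (hF : F = {x : H | ∀ i, (1/2 : ℝ) * ⟪x, Ti i x⟫ + ⟪ci i, x⟫ + α i ≤ 0})
    (hTc : CompactOp T) (hTr : IsClosed (Set.range fun x => T x))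
    (hTic : ∀ i, CompactOp (Ti i))
    (hTir : ∀ i, IsClosed (Set.range fun x => Ti i x))
    (hne : F.Nonempty) (hbd : BddBelow (f '' F))
    (hA : ∀ v ∈ recessionCone F, ⟪v, T v⟫ = 0 → ∀ i, Ti i ≠ 0 → ⟪ci i, v⟫ = 0)
    :
    ∃ xbar ∈ F, ∀ x ∈ F, f xbar ≤ f x := by
  have hmem : ∀ x, x ∈ F ↔ ∀ i, (1/2 : ℝ) * ⟪x, Ti i x⟫ + ⟪ci i, x⟫ + α i ≤ 0 := by
    intro x; rw [hF]; rfl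
  have hfc : Continuous f := by
    have : f = fun x => (1/2 : ℝ) * ⟪x, T x⟫ + ⟪c, x⟫ := funext hf
    rw [this]; fun_prop
  have hFc : IsClosed F := by
    rw [hF, Set.ofPred_forall]
    exact isClosed_iInter fun i => isClosed_le (by fun_prop) continuous_const
  -- A finite-dimensional subspace on which the whole problem lives.
  obtain ⟨V, hVfin, hVproj⟩ : ∃ V : Submodule ℝ H, FiniteDimensional ℝ V ∧
      ∀ x : H, ∃ y ∈ V, f y = f x ∧ (x ∈ F → y ∈ F) := by
    have h1 := hTc.finiteDimensional_range hT_sa hTr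
    have h2 := fun i => (hTic i).finiteDimensional_range (hTi_sa i) (hTir i)
    let V : Submodule ℝ H := (T.range ⊔ ⨆ i, (Ti i).range) ⊔
      (Submodule.span ℝ {c} ⊔ Submodule.span ℝ (Set.range ci))
    have hspan : FiniteDimensional ℝ (Submodule.span ℝ (Set.range ci)) :=
      FiniteDimensional.span_of_finite ℝ (Set.finite_range ci)
    have hfin : FiniteDimensional ℝ V := inferInstance
    refine ⟨V, hfin, fun x => ?_⟩
    obtain ⟨y, hy, z, hz, rfl⟩ := V.exists_add_mem_mem_orthogonal x
    have hker : ∀ A : H →L[ℝ] H, (∀ x y : H, ⟪A x, y⟫ = ⟪x, A y⟫) → A.range ≤ V → A z = 0 := by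
      intro A hsa hle
      rw [← inner_self_eq_zero (𝕜 := ℝ), hsa, real_inner_comm]
      exact hz _ (hle ⟨A z, rfl⟩)
    have hq : ∀ A : H →L[ℝ] H, (∀ x y : H, ⟪A x, y⟫ = ⟪x, A y⟫) → A.range ≤ V →
        ∀ a ∈ V, (1/2 : ℝ) * ⟪y + z, A (y + z)⟫ + ⟪a, y + z⟫ = (1/2 : ℝ) * ⟪y, A y⟫ + ⟪a, y⟫ := by
      intro A hsa hle a ha
      have h0 := hker A hsa hle
      have h3 : ⟪z, A y⟫ = 0 := by rw [← hsa, h0, inner_zero_left]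
      have h4 : ⟪a, z⟫ = 0 := hz a ha
      rw [map_add, h0, add_zero, inner_add_left, inner_add_right, h3, h4, add_zero, add_zero]
    have hTV : T.range ≤ V := le_sup_left.trans le_sup_left
    have hTiV : ∀ i, (Ti i).range ≤ V := fun i =>
      ((le_iSup (fun i => (Ti i).range) i).trans le_sup_right).trans le_sup_left
    have hcV : c ∈ V := (le_sup_left.trans le_sup_right : Submodule.span ℝ {c} ≤ V)
      (Submodule.mem_span_singleton_self c)
    have hciV : ∀ i, ci i ∈ V := fun i =>
      (le_sup_right.trans le_sup_right : Submodule.span ℝ (Set.range ci) ≤ V)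
        (Submodule.subset_span ⟨i, rfl⟩)
    refine ⟨y, hy, ?_, fun hx => ?_⟩
    · rw [hf, hf, hq T hT_sa hTV c hcV]
    · rw [hmem] at hx ⊢
      intro i
      have := hx i
      rwa [hq (Ti i) (hTi_sa i) (hTiV i) _ (hciV i)] at this
  set I := sInf (f '' F) with hI
  have hIle : ∀ x ∈ F, I ≤ f x := fun x hx => csInf_le hbd ⟨x, hx, rfl⟩
  -- Points of least norm in the shrinking sublevel sets.
  let S : ℕ → Set V := fun k => {x | (x : H) ∈ F ∧ f x ≤ I + 1 / ((k : ℝ) + 1)}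
  have hSc : ∀ k, IsClosed (S k) := fun k =>
    (hFc.preimage continuous_subtype_val).inter
      (isClosed_le (hfc.comp continuous_subtype_val) continuous_const)
  have hSne : ∀ k, (S k).Nonempty := by
    intro k
    obtain ⟨_, ⟨x, hx, rfl⟩, hlt⟩ := exists_lt_of_csInf_lt (hne.image f)
      (show sInf (f '' F) < I + 1 / ((k : ℝ) + 1) by
        linarith [Nat.one_div_pos_of_nat (α := ℝ) (n := k)])
    obtain ⟨y, hyV, hfy, hyF⟩ := hVproj x
    exact ⟨⟨y, hyV⟩, hyF hx, hfy.trans_le hlt.le⟩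
  have hmin : ∀ k, ∃ u ∈ S k, ∀ y ∈ S k, ‖u‖ ≤ ‖y‖ := by
    intro k
    obtain ⟨u, hu, hd⟩ := (hSc k).exists_infDist_eq_dist (hSne k) 0
    refine ⟨u, hu, fun y hy => ?_⟩
    have := Metric.infDist_le_dist_of_mem (x := 0) hy
    rwa [hd, dist_zero_left, dist_zero_left] at this
  choose u huS hu using hmin
  have hmono : Monotone fun k => ‖u k‖ := by
    intro k l hkl
    refine hu k _ ⟨(huS l).1, (huS l).2.trans ?_⟩
    gcongr
  rcases tendsto_atTop_of_monotone hmono with hinf | ⟨r, hr⟩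
  · exfalso
    -- The normalised sequence subconverges to a direction `v`.
    have hwb : ∀ k, ‖u k‖⁻¹ • u k ∈ Metric.closedBall (0 : V) 1 := by
      intro k
      rw [mem_closedBall_zero_iff, norm_smul, norm_inv, norm_norm]
      exact inv_mul_le_one
    obtain ⟨v', -, φ, hφ, hv'⟩ := tendsto_subseq_of_bounded Metric.isBounded_closedBall hwb
    set v : H := v'.1 with hvdef
    let w : ℕ → H := fun k => ((‖u (φ k)‖⁻¹ • u (φ k) : V) : H)
    let d : ℕ → ℝ := fun k => ‖u (φ k)‖
    have hw : Tendsto w atTop (𝓝 v) := (continuous_subtype_val.tendsto v').comp hv'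
    have hd : Tendsto d atTop atTop := hinf.comp hφ.tendsto_atTop
    have hdw : ∀ k, d k • w k = u (φ k) := by
      intro k
      by_cases h0 : u (φ k) = 0
      · simp [d, w, h0]
      · have : ‖u (φ k)‖ ≠ 0 := norm_ne_zero_iff.2 h0
        simp only [d, w, Submodule.coe_smul, smul_smul]
        rw [mul_inv_cancel₀ this, one_smul]
    have huF : ∀ k, (u k : H) ∈ F := fun k => (huS k).1
    have hTiv : ∀ i, Ti i v = 0 := fun i =>
      eq_zero_of_inner_apply_self_nonpos _ (hTi_sa i) (hTi_pos i)
        (inner_apply_self_nonpos_of_tendsto (Ti i) (c := ci i) (B := - α i) hw hd fun k => by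
          rw [hdw]; linarith [(hmem _).1 (huF (φ k)) i])
    have hciv : ∀ i, ⟪ci i, v⟫ ≤ 0 := fun i =>
      inner_nonpos_of_tendsto (B := - α i) hw hd fun k => by
        rw [hdw]; linarith [(hmem _).1 (huF (φ k)) i, hTi_pos i (u (φ k))]
    have hTv_le : ⟪v, T v⟫ ≤ 0 :=
      inner_apply_self_nonpos_of_tendsto T (c := c) (B := I + 1) hw hd fun k => by
        rw [hdw, ← hf]
        refine (huS (φ k)).2.trans ?_
        gcongr
        rw [div_le_one (by positivity)]
        linarith [(φ k).cast_nonneg (α := ℝ)]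
    have hrec : v ∈ recessionCone F := by
      intro x hx t ht
      rw [hmem] at hx ⊢
      intro i
      rw [quadratic_add_smul _ (hTi_sa i), hTiv i, inner_zero_right, inner_zero_right]
      nlinarith [hx i, mul_nonneg (neg_nonneg.2 (hciv i)) ht]
    have hray : ∀ x ∈ F, 0 ≤ 1/2 * ⟪v, T v⟫ ∧ (1/2 * ⟪v, T v⟫ = 0 → 0 ≤ ⟪x, T v⟫ + ⟪c, v⟫) := by
      intro x hx
      refine quadratic_bddBelow_on_ray (B := I) (a := f x) fun t ht => ?_
      rw [hf x, ← quadratic_add_smul T hT_sa, ← hf]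
      exact hIle _ (hrec x hx t ht)
    have hTv : ⟪v, T v⟫ = 0 := by
      obtain ⟨x, hx⟩ := hne
      linarith [(hray x hx).1]
    have hslope : ∀ x ∈ F, 0 ≤ ⟪x, T v⟫ + ⟪c, v⟫ := fun x hx =>
      (hray x hx).2 (by rw [hTv, mul_zero])
    have hAv := hA v hrec hTv
    -- Stepping back along `v` stays feasible and does not increase `f`.
    have hfeas : ∀ i, ∀ᶠ k in atTop, (1/2 : ℝ) * ⟪(u (φ k) : H) + (-1 : ℝ) • v,
        Ti i (u (φ k) + (-1 : ℝ) • v)⟫ + ⟪ci i, (u (φ k) : H) + (-1 : ℝ) • v⟫ + α i ≤ 0 := by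
      intro i
      simp only [quadratic_add_smul _ (hTi_sa i), hTiv i, inner_zero_right]
      rcases (hciv i).eq_or_lt with h0 | hneg
      · refine Eventually.of_forall fun k => ?_
        rw [h0]
        linarith [(hmem _).1 (huF (φ k)) i]
      · have hTi0 : Ti i = 0 := by
          by_contra h
          exact hneg.ne (hAv i h)
        have h1 : Tendsto (fun k => ⟪ci i, w k⟫) atTop (𝓝 ⟪ci i, v⟫) :=
          tendsto_const_nhds.inner hw
        filter_upwards [(hd.atTop_mul_neg hneg h1).eventually_le_atBot (⟪ci i, v⟫ - α i)] with k hk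
        rw [← inner_smul_right, hdw] at hk
        rw [hTi0, zero_apply, inner_zero_right]
        linarith
    have hvnorm : ‖v‖ = 1 := by
      refine tendsto_nhds_unique hw.norm (tendsto_const_nhds.congr' ?_)
      filter_upwards [hd.eventually_gt_atTop 0] with k hk
      have : ‖w k‖ = ‖u (φ k)‖⁻¹ * ‖u (φ k)‖ := by
        simp only [w, Submodule.coe_smul, norm_smul, norm_inv, norm_norm, Submodule.coe_norm]
      rw [this, inv_mul_cancel₀ hk.ne']
    have hin : ∀ᶠ k in atTop, 1 ≤ ⟪(u (φ k) : H), v⟫ := by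
      have h1 : Tendsto (fun k => ⟪w k, v⟫) atTop (𝓝 ⟪v, v⟫) := hw.inner tendsto_const_nhds
      rw [real_inner_self_eq_norm_sq, hvnorm, one_pow] at h1
      filter_upwards [(hd.atTop_mul_pos one_pos h1).eventually_ge_atTop 1] with k hk
      rwa [← real_inner_smul_left, hdw] at hk
    obtain ⟨k, hk, hkin⟩ := ((eventually_all.2 hfeas).and hin).exists
    have hle := hu (φ k) (u (φ k) + (-1 : ℝ) • v') ⟨(hmem _).2 hk, by
      refine le_trans ?_ (huS (φ k)).2
      rw [hf, hf, Submodule.coe_add, Submodule.coe_smul, quadratic_add_smul T hT_sa, ← hvdef, hTv]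
      linarith [hslope _ (huF (φ k))]⟩
    rw [Submodule.coe_norm, Submodule.coe_norm, Submodule.coe_add, Submodule.coe_smul,
      ← hvdef, neg_one_smul, ← sub_eq_add_neg] at hle
    have hsq := norm_sub_sq_real (u (φ k) : H) v
    rw [hvnorm] at hsq
    nlinarith [norm_nonneg (u (φ k) : H), norm_nonneg ((u (φ k) : H) - v)]
  · have hb : ∀ k, u k ∈ Metric.closedBall (0 : V) r := fun k =>
      mem_closedBall_zero_iff.2 (hmono.ge_of_tendsto hr k)
    obtain ⟨x, -, φ, hφ, hx⟩ := tendsto_subseq_of_bounded Metric.isBounded_closedBall hb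
    have hx' : Tendsto (fun k => ((u (φ k) : V) : H)) atTop (𝓝 (x : H)) :=
      (continuous_subtype_val.tendsto x).comp hx
    have hfx : f x ≤ I := by
      have h1 : Tendsto (fun k : ℕ => I + 1 / ((k : ℝ) + 1)) atTop (𝓝 (I + 0)) :=
        tendsto_const_nhds.add tendsto_one_div_add_atTop_nhds_zero_nat
      rw [add_zero] at h1
      exact le_of_tendsto_of_tendsto' ((hfc.tendsto _).comp hx') (h1.comp hφ.tendsto_atTop)
        fun k => (huS (φ k)).2
    exact ⟨x, hFc.mem_of_tendsto hx' (Eventually.of_forall fun k => (huS (φ k)).1),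
      fun y hy => hfx.trans (hIle y hy)⟩
end

section
/- Consider the linear programming problem in a Hilbert space: minimize f(x) = ⟨c, x⟩ over F = {x ∈ H : ⟨c_i, x⟩ + α_i ≤ 0 for all i = 1,…,m}. If F is nonempty and f is bounded from below on F, then f attains its infimum on F. -/
open scoped RealInnerProductSpace

/-- The indices of the constraints `L i x + α i ≤ 0` that are not tight at `x`. -/
noncomputable def inactiveConstraints {ι V : Type*} [Fintype ι] [AddCommGroup V] [Module ℝ V]
    (L : ι → V →ₗ[ℝ] ℝ) (α : ι → ℝ) (x : V) : Finset ι :=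
  {i | L i x + α i ≠ 0}

/-- If a linear functional bounded below on a polyhedron is negative along a direction in the
kernel of all constraints tight at `x`, then moving along it strictly enlarges the set of tight
constraints without increasing the functional. -/
theorem exists_inactiveConstraints_ssubset {ι V : Type*} [Fintype ι] [AddCommGroup V] [Module ℝ V]
    {L : ι → V →ₗ[ℝ] ℝ} {α : ι → ℝ} {g : V →ₗ[ℝ] ℝ} {b : ℝ}
    (hb : ∀ x, (∀ i, L i x + α i ≤ 0) → b ≤ g x) {x d : V} (hx : ∀ i, L i x + α i ≤ 0)
    (hd : ∀ i, L i x + α i = 0 → L i d = 0) (hgd : g d < 0) :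
    ∃ y, (∀ i, L i y + α i ≤ 0) ∧ g y ≤ g x ∧
      inactiveConstraints L α y ⊂ inactiveConstraints L α x := by
  by_cases hpos : ∃ j, 0 < L j d
  · obtain ⟨j, hj, hmin⟩ := Finset.exists_min_image (Finset.univ.filter fun j => 0 < L j d)
      (fun j => -(L j x + α j) / L j d) (by simpa [Finset.Nonempty] using hpos)
    simp only [Finset.mem_filter, Finset.mem_univ, true_and] at hj hmin
    set t := -(L j x + α j) / L j d
    have ht0 : 0 ≤ t := div_nonneg (by linarith [hx j]) hj.le
    have htj : t * L j d = -(L j x + α j) := div_mul_cancel₀ _ hj.ne'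
    refine ⟨x + t • d, fun i => ?_, ?_, ?_⟩
    · simp only [map_add, map_smul, smul_eq_mul]
      rcases le_or_gt (L i d) 0 with hi | hi
      · linarith [hx i, mul_nonpos_of_nonneg_of_nonpos ht0 hi]
      · linarith [(le_div_iff₀ hi).1 (hmin i hi)]
    · simp only [map_add, map_smul, smul_eq_mul]
      linarith [mul_nonpos_of_nonneg_of_nonpos ht0 hgd.le]
    · refine Finset.ssubset_iff_of_subset (fun i => ?_) |>.2 ⟨j, ?_, ?_⟩
      · simp only [inactiveConstraints, Finset.mem_filter, Finset.mem_univ, true_and, map_add,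
          map_smul, smul_eq_mul]
        intro hi h
        rw [hd i h] at hi
        exact hi (by linarith)
      · simpa [inactiveConstraints] using fun h => hj.ne' (hd j h)
      · simp only [inactiveConstraints, Finset.mem_filter, Finset.mem_univ, true_and, map_add,
          map_smul, smul_eq_mul, not_not]
        linarith
  · push Not at hpos
    have hs : 0 ≤ (g x - b + 1) / -g d := div_nonneg (by linarith [hb x hx]) (by linarith)
    have h := hb (x + ((g x - b + 1) / -g d) • d) fun i => by
      simp only [map_add, map_smul, smul_eq_mul]
      linarith [hx i, mul_nonpos_of_nonneg_of_nonpos hs (hpos i)]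
    have hmul : (g x - b + 1) / -g d * -g d = g x - b + 1 := div_mul_cancel₀ _ (by linarith)
    simp only [map_add, map_smul, smul_eq_mul] at h
    linarith

/-- Every point of a polyhedron on which a linear functional `g` is bounded below is dominated by
a point `y` such that `g` vanishes on the common kernel of the constraints tight at `y`. -/
theorem exists_le_forall_tight_eq_zero {ι V : Type*} [Fintype ι] [AddCommGroup V] [Module ℝ V]
    {L : ι → V →ₗ[ℝ] ℝ} {α : ι → ℝ} {g : V →ₗ[ℝ] ℝ} {b : ℝ}
    (hb : ∀ x, (∀ i, L i x + α i ≤ 0) → b ≤ g x) {x : V} (hx : ∀ i, L i x + α i ≤ 0) :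
    ∃ y, (∀ i, L i y + α i ≤ 0) ∧ g y ≤ g x ∧
      ∀ d, (∀ i, L i y + α i = 0 → L i d = 0) → g d = 0 := by
  obtain ⟨y, ⟨hy, hyx⟩, hmin⟩ := (measure fun y => (inactiveConstraints L α y).card).wf.has_min
    {y | (∀ i, L i y + α i ≤ 0) ∧ g y ≤ g x} ⟨x, hx, le_rfl⟩
  have key : ∀ d, (∀ i, L i y + α i = 0 → L i d = 0) → 0 ≤ g d := by
    intro d hd
    by_contra! hgd
    obtain ⟨z, hz, hzy, hlt⟩ := exists_inactiveConstraints_ssubset hb hy hd hgd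
    exact hmin z ⟨hz, hzy.trans hyx⟩ (Finset.card_lt_card hlt)
  refine ⟨y, hy, hyx, fun d hd => le_antisymm ?_ (key d hd)⟩
  have := key (-d) fun i hi => by simp [hd i hi]
  rw [map_neg] at this
  linarith

/-- A linear functional bounded below on a nonempty polyhedron attains its minimum there. -/
theorem exists_forall_le_of_polyhedron {ι V : Type*} [Fintype ι] [AddCommGroup V] [Module ℝ V]
    {L : ι → V →ₗ[ℝ] ℝ} {α : ι → ℝ} {g : V →ₗ[ℝ] ℝ} {b : ℝ}
    (hb : ∀ x, (∀ i, L i x + α i ≤ 0) → b ≤ g x) (hne : ∃ x, ∀ i, L i x + α i ≤ 0) :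
    ∃ y, (∀ i, L i y + α i ≤ 0) ∧ ∀ x, (∀ i, L i x + α i ≤ 0) → g y ≤ g x := by
  set G : Set V := {y | (∀ i, L i y + α i ≤ 0) ∧
    ∀ d, (∀ i, L i y + α i = 0 → L i d = 0) → g d = 0}
  have hG : ∀ y ∈ G, ∀ z ∈ G, inactiveConstraints L α y = inactiveConstraints L α z →
      g y = g z := by
    intro y hy z hz h
    refine sub_eq_zero.1 ((map_sub g y z).symm.trans (hy.2 _ fun i hi => ?_))
    have hzi : L i z + α i = 0 := by
      have := Finset.ext_iff.1 h i
      simp only [inactiveConstraints, Finset.mem_filter, Finset.mem_univ, true_and] at this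
      tauto
    rw [map_sub]
    linarith
  have hfin : (g '' G).Finite := by
    choose! r hrG hr using fun (S : Finset ι) (hS : ∃ y ∈ G, inactiveConstraints L α y = S) => hS
    refine (Set.finite_range (g ∘ r)).subset ?_
    rintro _ ⟨y, hy, rfl⟩
    exact ⟨_, hG _ (hrG _ ⟨y, hy, rfl⟩) y hy (hr _ ⟨y, hy, rfl⟩)⟩
  obtain ⟨x₀, hx₀⟩ := hne
  obtain ⟨y₀, hy₀, -, hy₀'⟩ := exists_le_forall_tight_eq_zero hb hx₀
  obtain ⟨_, ⟨y, hy, rfl⟩, hmin⟩ := Set.exists_min_image (g '' G) id hfin ⟨_, y₀, ⟨hy₀, hy₀'⟩, rfl⟩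
  refine ⟨y, hy.1, fun x hx => ?_⟩
  obtain ⟨z, hz, hzx, hz'⟩ := exists_le_forall_tight_eq_zero hb hx
  exact (hmin _ ⟨z, ⟨hz, hz'⟩, rfl⟩).trans hzx

/-- Linear programming in Hilbert space: if `F` (defined by finitely many linear
inequalities) is nonempty and the linear objective `f(x) = ⟪c, x⟫` is bounded from below
on `F`, then `f` attains its infimum on `F`. -/
theorem linear_programming_hilbert
    {H : Type*} [NormedAddCommGroup H] [InnerProductSpace ℝ H] [CompleteSpace H]
    {m : ℕ} (c : H) (ci : Fin m → H) (α : Fin m → ℝ)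
    (f : H → ℝ) (hf : ∀ x, f x = ⟪c, x⟫)
    (F : Set H)
    (hF : F = {x : H | ∀ i, ⟪ci i, x⟫ + α i ≤ 0})
    (hne : F.Nonempty) (hbd : BddBelow (f '' F)) :
    ∃ xbar ∈ F, ∀ x ∈ F, f xbar ≤ f x := by
  subst hF
  obtain ⟨b, hb⟩ := hbd
  obtain ⟨y, hy, hmin⟩ := exists_forall_le_of_polyhedron
    (L := fun i => (innerSL ℝ (ci i)).toLinearMap) (α := α) (g := (innerSL ℝ c).toLinearMap)
    (b := b) (fun x hx => (hb ⟨x, hx, rfl⟩).trans_eq (hf x)) hne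
  refine ⟨y, hy, fun x hx => ?_⟩
  rw [hf, hf]
  exact hmin x hx
end

section
/- Let T be a compact operator with closed range. If the quadratic function f(x) = (1/2)⟨x, T x⟩ + ⟨c, x⟩ is bounded from below on all of H, then there exists x* ∈ H such that f(x*) ≤ f(x) for all x ∈ H. -/
open scoped RealInnerProductSpace
open Filter Topology

/-- If `t ↦ t ^ 2 * a + t * b` is bounded from below on `ℝ`, then `a` is nonnegative. -/
lemma nonneg_of_quadratic_bounded_below {a b m : ℝ} (h : ∀ t : ℝ, m ≤ t ^ 2 * a + t * b) :
    0 ≤ a := by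
  by_contra! ha
  set t : ℝ := (1 + |m|) / (-a) + 1 with ht
  have hq : 0 ≤ (1 + |m|) / (-a) := div_nonneg (by positivity) (by linarith)
  have hta : t * a = -(1 + |m|) + a := by
    rw [ht]
    field_simp [ha.ne]
  have h1 := h t
  have h2 := h (-t)
  have h3 : t ^ 2 * a ≤ t * a := by
    have : 0 ≤ t * (t - 1) * (-a) :=
      mul_nonneg (mul_nonneg (by linarith) (by linarith)) (by linarith)
    nlinarith
  have h4 := neg_abs_le m
  nlinarith

/-- A linear function of a real variable that is bounded from below has slope zero. -/
lemma eq_zero_of_linear_bounded_below {b m : ℝ} (h : ∀ t : ℝ, m ≤ t * b) : b = 0 := by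
  by_contra hb
  have := h ((m - 1) / b)
  rw [div_mul_cancel₀ _ hb] at this
  linarith

/-- If the range of a symmetric operator is closed, it contains every vector orthogonal to the
kernel. -/
lemma exists_map_eq_of_orthogonal_ker {H : Type*} [NormedAddCommGroup H]
    [InnerProductSpace ℝ H] [CompleteSpace H] (T : H →L[ℝ] H)
    (hT : ∀ x y : H, ⟪T x, y⟫ = ⟪x, T y⟫) (hr : IsClosed (Set.range fun x => T x))
    {c : H} (hc : ∀ y, T y = 0 → ⟪c, y⟫ = 0) : ∃ z, T z = c := by
  let K : Submodule ℝ H := LinearMap.range T.toLinearMap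
  have hK : IsClosed (K : Set H) := by
    simpa [K, LinearMap.coe_range] using hr
  have : CompleteSpace K := hK.completeSpace_coe
  have hcK : c ∈ Kᗮᗮ := by
    rw [Submodule.mem_orthogonal']
    intro y hy
    refine hc y ?_
    have h := (Submodule.mem_orthogonal K y).1 hy (T (T y)) ⟨T y, rfl⟩
    rw [hT] at h
    exact inner_self_eq_zero.1 h
  rw [Submodule.orthogonal_orthogonal] at hcK
  exact hcK

/-- If `T` is compact with closed range and `f(x) = (1/2)⟪x, T x⟫ + ⟪c, x⟫` is bounded
from below on all of `H`, then `f` attains its global minimum. -/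
theorem compact_global_minimum
    {H : Type*} [NormedAddCommGroup H] [InnerProductSpace ℝ H] [CompleteSpace H]
    (T : H →L[ℝ] H) (hT_sa : ∀ x y : H, ⟪T x, y⟫ = ⟪x, T y⟫) (c : H)
    (f : H → ℝ) (hf : ∀ x, f x = (1/2 : ℝ) * ⟪x, T x⟫ + ⟪c, x⟫)
    (hTc : CompactOp T) (hTr : IsClosed (Set.range fun x => T x))
    (hbd : BddBelow (Set.range f)) :
    ∃ xs : H, ∀ x : H, f xs ≤ f x := by
  obtain ⟨m, hm⟩ := hbd
  have hline : ∀ (x : H) (t : ℝ), m ≤ t ^ 2 * ((1/2 : ℝ) * ⟪x, T x⟫) + t * ⟪c, x⟫ := by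
    intro x t
    have h := hm ⟨t • x, rfl⟩
    rw [hf, map_smul, real_inner_smul_left, real_inner_smul_right, real_inner_smul_right] at h
    linarith
  have hpos : ∀ x : H, 0 ≤ ⟪x, T x⟫ := fun x => by
    linarith [nonneg_of_quadratic_bounded_below (hline x)]
  obtain ⟨z, rfl⟩ := exists_map_eq_of_orthogonal_ker T hT_sa hTr (c := c) fun y hy =>
    eq_zero_of_linear_bounded_below (m := m) fun t => by simpa [hy] using hline y t
  refine ⟨-z, fun x => ?_⟩
  have h := hpos (x + z)
  have hxz : ⟪z, T x⟫ = ⟪x, T z⟫ := by rw [← hT_sa, real_inner_comm]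
  rw [map_add, inner_add_left, inner_add_right, inner_add_right, hxz] at h
  rw [hf, hf, map_neg, inner_neg_neg, inner_neg_right, real_inner_comm x (T z),
    real_inner_comm z (T z)]
  linarith
end
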